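/- Let q = s^2 be a square prime power, let n be odd, and let X be a hypersurface of degree d = s+1 and dimension n in P^{n+1} over F_q with 0 < k_X ≤ n−1 such that N_q(X) = Θ_{n,k_X}^{s+1,q}. Then X has a singular F_q-point. -/

import Mathlib

/-- `NP q N` is the number of `F_q`-points of `P^N`, i.e. `q^N + q^(N-1) + … + q + 1`. -/
def NP (q N : ℕ) : ℕ := ∑ i ∈ Finset.range (N + 1), q ^ i

/-- `Theta q d n k` is the quantity `Θ_{n,k}^{d,q} = (d-1)·q^k·N_q(P^{n-k}) + N_q(P^k)`. -/
def Theta (q d n k : ℕ) : ℕ := (d - 1) * q ^ k * NP q (n - k) + NP q k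

/-- The number of `F`-rational points of the hypersurface `f = 0` in `P^{m-1}`. -/
noncomputable def numPoints {F : Type*} [Field F] {m : ℕ}
    (f : MvPolynomial (Fin m) F) : ℕ :=
  Nat.card {p : Projectivization F (Fin m → F) // MvPolynomial.eval p.rep f = 0}

/-- The projective linear subspace `P(W)` is contained in the hypersurface `f = 0`. -/
def SubInX {F : Type*} [Field F] {m : ℕ}
    (f : MvPolynomial (Fin m) F) (W : Submodule F (Fin m → F)) : Prop :=
  ∀ v ∈ W, MvPolynomial.eval v f = 0

/-- The Thas invariant of the hypersurface `f = 0` equals `k`: there is an `F`-linear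
projective subspace of dimension `k` contained in it, and none of dimension `k + 1`. -/
def ThasEq {F : Type*} [Field F] {m : ℕ}
    (f : MvPolynomial (Fin m) F) (k : ℕ) : Prop :=
  (∃ W : Submodule F (Fin m → F), Module.finrank F W = k + 1 ∧ SubInX f W) ∧
  ¬ ∃ W : Submodule F (Fin m → F), Module.finrank F W = k + 2 ∧ SubInX f W

/-- `v` is a homogeneous coordinate vector of a singular `F`-point of `f = 0`. -/
def IsSingPt {F : Type*} [Field F] {m : ℕ}
    (f : MvPolynomial (Fin m) F) (v : Fin m → F) : Prop :=
  v ≠ 0 ∧ MvPolynomial.eval v f = 0 ∧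
    ∀ i, MvPolynomial.eval v (MvPolynomial.pderiv i f) = 0

section

open Polynomial in
/-- The univariate polynomial `t ↦ f (v + t w)`. -/
noncomputable def linePoly {F : Type*} [Field F] {m : ℕ} (f : MvPolynomial (Fin m) F)
    (v w : Fin m → F) : F[X] :=
  MvPolynomial.aeval (fun i => C (v i) + C (w i) * X) f

/-- The differential of `f` at `v`, as a linear form. -/
noncomputable def differential {F : Type*} [Field F] {m : ℕ} (f : MvPolynomial (Fin m) F)
    (v : Fin m → F) : (Fin m → F) →ₗ[F] F :=
  ∑ i, MvPolynomial.eval v (MvPolynomial.pderiv i f) • LinearMap.proj i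

variable {F : Type*} [Field F] {m : ℕ}

theorem differential_apply (f : MvPolynomial (Fin m) F) (v w : Fin m → F) :
    differential f v w = ∑ i, MvPolynomial.eval v (MvPolynomial.pderiv i f) * w i := by
  simp [differential]

theorem eval_linePoly (f : MvPolynomial (Fin m) F) (v w : Fin m → F) (t : F) :
    (linePoly f v w).eval t = MvPolynomial.eval (v + t • w) f := by
  unfold linePoly
  induction f using MvPolynomial.induction_on with
  | C a => simp
  | add p q hp hq => simp [hp, hq]
  | mul_X p i hp =>
    simp only [map_mul, MvPolynomial.aeval_X, Polynomial.eval_mul, hp]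
    simp [mul_comm t]

theorem coeff_one_linePoly (f : MvPolynomial (Fin m) F) (v w : Fin m → F) :
    (linePoly f v w).coeff 1 = differential f v w := by
  rw [differential_apply]
  induction f using MvPolynomial.induction_on with
  | C a => simp [linePoly]
  | add p q hp hq =>
    rw [linePoly, map_add, Polynomial.coeff_add]
    simp only [linePoly] at hp hq
    simp [hp, hq, add_mul, Finset.sum_add_distrib]
  | mul_X p i hp =>
    have h0 : (linePoly p v w).coeff 0 = MvPolynomial.eval v p := by
      rw [Polynomial.coeff_zero_eq_eval_zero, eval_linePoly]; simp
    have h : linePoly (p * MvPolynomial.X i) v w =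
        linePoly p v w * Polynomial.C (v i) + linePoly p v w * Polynomial.C (w i) * Polynomial.X := by
      simp [linePoly]; ring
    rw [h]
    simp [hp, h0, Finset.sum_mul, add_mul, Finset.sum_add_distrib, Pi.single_apply,
      apply_ite, ite_mul, add_comm]
    exact Finset.sum_congr rfl fun _ _ => by ring

theorem reflect_linear_prod (v w : Fin m → F) (d : Fin m →₀ ℕ) :
    let g : (Fin m → F) → (Fin m → F) → Polynomial F := fun v w =>
      ∏ i, (Polynomial.C (v i) + Polynomial.C (w i) * Polynomial.X) ^ d i
    (g v w).natDegree ≤ ∑ i, d i ∧ (g v w).reflect (∑ i, d i) = g w v := by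
  have hlin : ∀ i, (Polynomial.C (v i) + Polynomial.C (w i) * Polynomial.X).natDegree ≤ 1 := by
    intro i
    compute_degree
  have hpow : ∀ i (e : ℕ),
      ((Polynomial.C (v i) + Polynomial.C (w i) * Polynomial.X) ^ e).natDegree ≤ e := by
    intro i e
    simpa using Polynomial.natDegree_pow_le_of_le e (hlin i)
  have hrefl : ∀ i (e : ℕ),
      ((Polynomial.C (v i) + Polynomial.C (w i) * Polynomial.X) ^ e).reflect e =
        (Polynomial.C (w i) + Polynomial.C (v i) * Polynomial.X) ^ e := by
    intro i e
    induction e with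
    | zero => simp
    | succ e ih =>
      rw [pow_succ, pow_succ, Polynomial.reflect_mul _ _ (hpow i e) (hlin i), ih,
        Polynomial.reflect_add, Polynomial.reflect_C_mul, Polynomial.reflect_one_X,
        Polynomial.reflect_C]
      ring
  intro g
  suffices ∀ S : Finset (Fin m),
      (∏ i ∈ S, (Polynomial.C (v i) + Polynomial.C (w i) * Polynomial.X) ^ d i).natDegree ≤
        ∑ i ∈ S, d i ∧
      (∏ i ∈ S, (Polynomial.C (v i) + Polynomial.C (w i) * Polynomial.X) ^ d i).reflect
        (∑ i ∈ S, d i) =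
        ∏ i ∈ S, (Polynomial.C (w i) + Polynomial.C (v i) * Polynomial.X) ^ d i from this _
  intro S
  induction S using Finset.cons_induction with
  | empty => simp
  | cons a S ha ih =>
    simp only [Finset.prod_cons, Finset.sum_cons]
    refine ⟨Polynomial.natDegree_mul_le.trans (add_le_add (hpow a _) ih.1), ?_⟩
    rw [Polynomial.reflect_mul _ _ (hpow a _) ih.1, hrefl, ih.2]

theorem linePoly_eq_sum (f : MvPolynomial (Fin m) F) (v w : Fin m → F) :
    linePoly f v w = ∑ d ∈ f.support, Polynomial.C (f.coeff d) *
      ∏ i, (Polynomial.C (v i) + Polynomial.C (w i) * Polynomial.X) ^ d i := by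
  rw [linePoly, MvPolynomial.aeval_def, MvPolynomial.eval₂_eq']
  rfl

variable {e : ℕ} {f : MvPolynomial (Fin m) F}

theorem sum_eq_of_mem_support (hf : f.IsHomogeneous e) {d : Fin m →₀ ℕ} (hd : d ∈ f.support) :
    ∑ i, d i = e := by
  have := hf (MvPolynomial.mem_support_iff.1 hd)
  rw [← this, Finsupp.weight_apply, Finsupp.sum_fintype] <;> simp

theorem natDegree_linePoly_le (hf : f.IsHomogeneous e) (v w : Fin m → F) :
    (linePoly f v w).natDegree ≤ e := by
  rw [linePoly_eq_sum]
  refine Polynomial.natDegree_sum_le_of_forall_le _ _ fun d hd => ?_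
  refine (Polynomial.natDegree_C_mul_le _ _).trans ?_
  exact sum_eq_of_mem_support hf hd ▸ (reflect_linear_prod v w d).1

theorem reflect_linePoly (hf : f.IsHomogeneous e) (v w : Fin m → F) :
    (linePoly f v w).reflect e = linePoly f w v := by
  rw [linePoly_eq_sum, linePoly_eq_sum]
  have hsum : ∀ (S : Finset (Fin m →₀ ℕ)) (g : (Fin m →₀ ℕ) → Polynomial F),
      (∑ d ∈ S, g d).reflect e = ∑ d ∈ S, (g d).reflect e := by
    intro S g
    ext j
    simp [Polynomial.coeff_reflect]
  rw [hsum]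
  refine Finset.sum_congr rfl fun d hd => ?_
  rw [Polynomial.reflect_C_mul]
  congr 1
  exact sum_eq_of_mem_support hf hd ▸ (reflect_linear_prod v w d).2

theorem coeff_linePoly_symm (hf : f.IsHomogeneous e) (v w : Fin m → F) {i j : ℕ} (h : i + j = e) :
    (linePoly f v w).coeff i = (linePoly f w v).coeff j := by
  rw [← reflect_linePoly hf w v, Polynomial.coeff_reflect, Polynomial.revAt_le (by omega)]
  congr 1
  omega

theorem coeff_zero_linePoly (f : MvPolynomial (Fin m) F) (v w : Fin m → F) :
    (linePoly f v w).coeff 0 = MvPolynomial.eval v f := by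
  rw [Polynomial.coeff_zero_eq_eval_zero, eval_linePoly]; simp

theorem eval_smul_of_isHomogeneous (hf : f.IsHomogeneous e) (c : F) (v : Fin m → F) :
    MvPolynomial.eval (c • v) f = c ^ e * MvPolynomial.eval v f := by
  rw [MvPolynomial.eval_eq', MvPolynomial.eval_eq', Finset.mul_sum]
  refine Finset.sum_congr rfl fun d hd => ?_
  simp only [Pi.smul_apply, smul_eq_mul, mul_pow, Finset.prod_mul_distrib,
    Finset.prod_pow_eq_pow_sum, sum_eq_of_mem_support hf hd]
  ring

/-- A nonzero polynomial of degree at most `d` divisible by `X ^ j` has at most `d - j` nonzero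
roots. -/
theorem card_nonzero_roots_add_le [Fintype F] [DecidableEq F] {P : Polynomial F} {d j : ℕ}
    (hP : P ≠ 0) (hd : P.natDegree ≤ d) (hj : ∀ i < j, P.coeff i = 0) :
    (Finset.univ.filter fun t : F => t ≠ 0 ∧ P.eval t = 0).card + j ≤ d := by
  obtain ⟨Q, rfl⟩ := Polynomial.X_pow_dvd_iff.2 hj
  have hQ : Q ≠ 0 := right_ne_zero_of_mul hP
  rw [Polynomial.natDegree_mul (pow_ne_zero _ Polynomial.X_ne_zero) hQ,
    Polynomial.natDegree_X_pow] at hd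
  have h : (Finset.univ.filter fun t : F => t ≠ 0 ∧ (Polynomial.X ^ j * Q).eval t = 0) ⊆
      Q.roots.toFinset := by
    intro t ht
    simp only [Finset.mem_filter, Finset.mem_univ, true_and, Polynomial.eval_mul,
      Polynomial.eval_pow, Polynomial.eval_X, mul_eq_zero] at ht
    have := pow_ne_zero j ht.1
    simp [hQ, Polynomial.IsRoot]
    tauto
  have := (Finset.card_le_card h).trans ((Multiset.toFinset_card_le _).trans Q.card_roots')
  omega
variable {s k : ℕ} {W : Submodule F (Fin m → F)}

theorem natDegree_linePoly_le_of_eval_eq_zero (hf : f.IsHomogeneous (s + 1)) (v : Fin m → F)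
    {u : Fin m → F} (hu : MvPolynomial.eval u f = 0) : (linePoly f v u).natDegree ≤ s := by
  refine Polynomial.natDegree_le_iff_coeff_eq_zero.2 fun i hi => ?_
  rcases (Nat.succ_le_of_lt hi).eq_or_lt with h | h
  · rw [← h, coeff_linePoly_symm hf v u (j := 0) rfl, coeff_zero_linePoly, hu]
  · exact Polynomial.coeff_eq_zero_of_natDegree_lt ((natDegree_linePoly_le hf v u).trans_lt h)

theorem coeff_linePoly_eq_differential (hf : f.IsHomogeneous (s + 1)) (v u : Fin m → F) :
    (linePoly f v u).coeff s = differential f u v := by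
  rw [coeff_linePoly_symm hf v u (j := 1) rfl, coeff_one_linePoly]

theorem natDegree_linePoly_le_pred (hf : f.IsHomogeneous (s + 1)) (v : Fin m → F)
    {u : Fin m → F} (hu : MvPolynomial.eval u f = 0) (h : differential f u v = 0) :
    (linePoly f v u).natDegree ≤ s - 1 := by
  refine Polynomial.natDegree_le_iff_coeff_eq_zero.2 fun i hi => ?_
  rcases (show s ≤ i by omega).eq_or_lt with h' | h'
  · rw [← h', coeff_linePoly_eq_differential hf, h]
  · exact Polynomial.coeff_eq_zero_of_natDegree_lt
      ((natDegree_linePoly_le_of_eval_eq_zero hf v hu).trans_lt h')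

theorem exists_eval_add_ne_zero (hf : f.IsHomogeneous e) (hWr : Module.finrank F W = k + 1)
    (hW : SubInX f W)
    (hmax : ¬ ∃ W' : Submodule F (Fin m → F), Module.finrank F W' = k + 2 ∧ SubInX f W')
    {y : Fin m → F} (hy : y ∉ W) : ∃ b : W, MvPolynomial.eval (y + (b : Fin m → F)) f ≠ 0 := by
  by_contra! h
  refine hmax ⟨W ⊔ Submodule.span F {y}, by rw [Submodule.finrank_sup_span_singleton hy, hWr], ?_⟩
  intro v hv
  obtain ⟨w, hw, z, hz, rfl⟩ := Submodule.mem_sup.1 hv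
  obtain ⟨c, rfl⟩ := Submodule.mem_span_singleton.1 hz
  by_cases hc : c = 0
  · simpa [hc] using hW w hw
  · have h1 : w + c • y = c • (y + c⁻¹ • w) := by
      rw [smul_add, smul_inv_smul₀ hc, add_comm]
    rw [h1, eval_smul_of_isHomogeneous hf, h ⟨_, W.smul_mem c⁻¹ hw⟩, mul_zero]

/-- The number of zeros of `f` on the affine subspace `y + W`. -/
noncomputable def cosetZeros (f : MvPolynomial (Fin m) F) (W : Submodule F (Fin m → F))
    [Fintype W] [DecidableEq F] (y : Fin m → F) : ℕ :=
  (Finset.univ.filter fun a : W => MvPolynomial.eval (y + (a : Fin m → F)) f = 0).card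

section

variable [Fintype W] [DecidableEq F]

theorem cosetZeros_add_mem (f : MvPolynomial (Fin m) F) (y : Fin m → F) (b : W) :
    cosetZeros f W (y + b) = cosetZeros f W y := by
  unfold cosetZeros
  refine Finset.card_equiv (Equiv.addLeft b) fun a => ?_
  simp [add_assoc]

end

variable [Fintype F]

theorem differential_eq_zero_of_mem (hf : f.IsHomogeneous e) (he : e < Fintype.card F)
    (hW : SubInX f W) {u a : Fin m → F} (hu : u ∈ W) (ha : a ∈ W) : differential f u a = 0 := by
  have h : linePoly f u a = 0 := by
    refine Polynomial.eq_zero_of_natDegree_lt_card_of_eval_eq_zero _ Function.injective_id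
      (fun t => ?_) ((natDegree_linePoly_le hf u a).trans_lt he)
    rw [eval_linePoly]
    exact hW _ (W.add_mem hu (W.smul_mem _ ha))
  rw [← coeff_one_linePoly, h, Polynomial.coeff_zero]

theorem differential_add_of_mem (hf : f.IsHomogeneous e) (he : e < Fintype.card F)
    (hW : SubInX f W) (u a : W) (y : Fin m → F) :
    differential f u (y + a) = differential f u y := by
  rw [map_add, differential_eq_zero_of_mem hf he hW u.2 a.2, add_zero]

variable [DecidableEq F]

theorem card_linear_form_eq_zero {V : Type*} [AddCommGroup V] [Module F V] [Fintype V]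
    {φ : V →ₗ[F] F} (hφ : φ ≠ 0) (hV : Module.finrank F V = k + 1) :
    (Finset.univ.filter fun v => φ v = 0).card = Fintype.card F ^ k := by
  have h := Module.Dual.finrank_ker_add_one_of_ne_zero (K := F) hφ
  have hker : Nat.card (LinearMap.ker φ) = Fintype.card F ^ k := by
    rw [Module.natCard_eq_pow_finrank (K := F), Nat.card_eq_fintype_card]
    congr 1
    omega
  rw [← hker, ← Fintype.card_subtype, ← Nat.card_eq_fintype_card]
  rfl

variable [Fintype W]

theorem sum_card_zeros_parallel_lines (f : MvPolynomial (Fin m) F) (y : Fin m → F) (u : W) :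
    ∑ a : W, (Finset.univ.filter fun t : F => (linePoly f (y + a) u).eval t = 0).card =
      Fintype.card F * cosetZeros f W y := by
  simp only [Finset.card_filter]
  rw [Finset.sum_comm]
  have h : ∀ t : F, (∑ a : W, if (linePoly f (y + a) u).eval t = 0 then 1 else 0) =
      cosetZeros f W y := by
    intro t
    rw [← Finset.card_filter, ← cosetZeros_add_mem f y (t • u), cosetZeros]
    congr 1
    ext a
    simp [eval_linePoly, add_right_comm]
  simp [h]

theorem sum_card_zeros_concurrent_lines (f : MvPolynomial (Fin m) F) (y : Fin m → F) :
    ∑ u : W, (Finset.univ.filter fun t : F => t ≠ 0 ∧ (linePoly f y u).eval t = 0).card =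
      (Fintype.card F - 1) * cosetZeros f W y := by
  simp only [Finset.card_filter]
  rw [Finset.sum_comm]
  have h : ∀ t : F, (∑ u : W, if t ≠ 0 ∧ (linePoly f y u).eval t = 0 then 1 else 0) =
      if t ≠ 0 then cosetZeros f W y else 0 := by
    intro t
    split_ifs with ht
    · rw [← Finset.card_filter, cosetZeros]
      refine Finset.card_equiv (LinearEquiv.smulOfNeZero F W t ht).toEquiv fun a => ?_
      simp [ht, eval_linePoly]
    · simp [ht]
  simp_rw [h]
  rw [← Finset.sum_filter, Finset.sum_const, smul_eq_mul, Finset.filter_ne',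
    Finset.card_erase_of_mem (Finset.mem_univ _), Finset.card_univ]

theorem card_line_zeros_le (hf : f.IsHomogeneous (s + 1)) {v u : Fin m → F}
    (hu : MvPolynomial.eval u f = 0) (h : differential f u v ≠ 0) :
    (Finset.univ.filter fun t : F => (linePoly f v u).eval t = 0).card ≤ s := by
  have hP : linePoly f v u ≠ 0 := by
    intro h0
    rw [← coeff_linePoly_eq_differential hf, h0] at h
    simp at h
  refine le_trans ?_ ((linePoly f v u).card_roots'.trans
    (natDegree_linePoly_le_of_eval_eq_zero hf v hu))
  refine (Finset.card_le_card fun t ht => ?_).trans (Multiset.toFinset_card_le _)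
  simpa [hP] using ht

theorem cosetZeros_le_of_differential_ne_zero (hf : f.IsHomogeneous (s + 1))
    (hs : s + 1 < Fintype.card F) (hW : SubInX f W)
    (hWc : Fintype.card W = Fintype.card F ^ (k + 1))
    {y : Fin m → F} {u : W} (hu : differential f u y ≠ 0) :
    cosetZeros f W y ≤ s * Fintype.card F ^ k := by
  have h := sum_card_zeros_parallel_lines f y u
  have hle := Finset.sum_le_sum fun (a : W) (_ : a ∈ Finset.univ) =>
    card_line_zeros_le (v := y + a) hf (hW u u.2) (by rwa [differential_add_of_mem hf hs hW])
  rw [h, Finset.sum_const, Finset.card_univ, hWc, smul_eq_mul] at hle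
  have hq : 0 < Fintype.card F := by omega
  refine Nat.le_of_mul_le_mul_left (hle.trans_eq ?_) hq
  ring

theorem cosetZeros_lt_of_differential_eq_zero (hf : f.IsHomogeneous (s + 1)) (hs0 : 0 < s)
    (hs : s + 1 < Fintype.card F) (hW : SubInX f W)
    (hWc : Fintype.card W = Fintype.card F ^ (k + 1))
    {y : Fin m → F} (hu : ∀ u : W, differential f u y = 0)
    (hne : ∃ b : W, MvPolynomial.eval (y + (b : Fin m → F)) f ≠ 0) :
    cosetZeros f W y < s * Fintype.card F ^ k := by
  obtain ⟨b, hb⟩ := hne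
  have h := sum_card_zeros_concurrent_lines (W := W) f (y + b)
  have hle := Finset.sum_le_sum fun (u : W) (_ : u ∈ Finset.univ) =>
    card_nonzero_roots_add_le (P := linePoly f (y + b) u) (d := s - 1) (j := 0)
      (fun h0 => hb <| by rw [← coeff_zero_linePoly f _ u, h0, Polynomial.coeff_zero])
      (natDegree_linePoly_le_pred hf _ (hW u u.2) (by rw [differential_add_of_mem hf hs hW, hu]))
      (by simp)
  simp only [add_zero] at hle
  rw [h, Finset.sum_const, Finset.card_univ, hWc, smul_eq_mul, cosetZeros_add_mem] at hle
  obtain ⟨r, rfl⟩ : ∃ r, s = r + 1 := ⟨s - 1, by omega⟩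
  obtain ⟨c, hc⟩ : ∃ c, Fintype.card F = c + 1 := ⟨Fintype.card F - 1, by omega⟩
  rw [hc] at hle hs ⊢
  simp only [add_tsub_cancel_right] at hle
  have hpos : 0 < (c + 1) ^ k := by positivity
  refine Nat.lt_of_mul_lt_mul_left (hle.trans_lt ?_)
  rw [pow_succ]
  nlinarith

theorem card_differential_eq_zero (hf : f.IsHomogeneous (s + 1)) (hs2 : 2 ≤ s)
    (hs : s + 1 < Fintype.card F) (hW : SubInX f W) (hWr : Module.finrank F W = k + 1)
    {y : Fin m → F} (hu : ∃ u : W, differential f u y ≠ 0)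
    (hy : cosetZeros f W y = s * Fintype.card F ^ k) :
    (Finset.univ.filter fun u : W => differential f u y = 0).card = Fintype.card F ^ k := by
  have hWc : Fintype.card W = Fintype.card F ^ (k + 1) := by
    rw [Module.card_eq_pow_finrank (K := F), hWr]
  have hqk : 0 < Fintype.card F ^ k := pow_pos (by omega) k
  have exact_line : ∀ u : W, differential f u y ≠ 0 → ∀ a : W,
      (Finset.univ.filter fun t : F => (linePoly f (y + a) u).eval t = 0).card = s := by
    intro u hu a
    refine (Finset.sum_eq_sum_iff_of_le fun (a : W) (_ : a ∈ Finset.univ) =>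
      card_line_zeros_le (v := y + a) hf (hW u u.2)
        (by rwa [differential_add_of_mem hf hs hW])).1 ?_ a (Finset.mem_univ a)
    rw [sum_card_zeros_parallel_lines, hy, Finset.sum_const, Finset.card_univ, hWc, smul_eq_mul]
    ring
  obtain ⟨a, ha⟩ : ∃ a : W, MvPolynomial.eval (y + (a : Fin m → F)) f = 0 := by
    have : 0 < cosetZeros f W y := by rw [hy]; positivity
    obtain ⟨a, ha⟩ := Finset.card_pos.1 this
    exact ⟨a, by simpa using ha⟩
  set φ : W →ₗ[F] F := (differential f (y + a)).comp W.subtype with hφ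
  have hφu : ∀ u : W, φ u = (linePoly f (y + a) u).coeff 1 := by
    intro u
    rw [coeff_one_linePoly]
    rfl
  have hcard : ∀ u : W, (Finset.univ.filter fun t : F => (linePoly f (y + a) u).eval t = 0).card =
      (Finset.univ.filter fun t : F => t ≠ 0 ∧ (linePoly f (y + a) u).eval t = 0).card + 1 := by
    intro u
    rw [← Finset.filter_filter, Finset.filter_ne', Finset.filter_erase,
      Finset.card_erase_add_one]
    simp [← Polynomial.coeff_zero_eq_eval_zero, coeff_zero_linePoly, ha]
  have hdeg : ∀ u : W, (linePoly f (y + a) u).natDegree ≤ s := fun u =>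
    natDegree_linePoly_le_of_eval_eq_zero hf _ (hW u u.2)
  have ker_le : ∀ u : W, φ u = 0 → differential f u y = 0 := by
    intro u h0
    by_contra hu
    have hP : linePoly f (y + a) u ≠ 0 := by
      intro h
      rw [← differential_add_of_mem hf hs hW u a, ← coeff_linePoly_eq_differential hf, h] at hu
      simp at hu
    have h := card_nonzero_roots_add_le (j := 2) hP (hdeg u) (by
      intro i hi
      interval_cases i
      · rw [coeff_zero_linePoly, ha]
      · rw [← hφu, h0])
    have := exact_line u hu a
    have := hcard u
    omega
  have hφ0 : φ ≠ 0 := by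
    rintro h
    obtain ⟨u, hu⟩ := hu
    exact hu (ker_le u (by rw [h]; rfl))
  have hker : (Finset.univ.filter fun u : W => φ u = 0).card = Fintype.card F ^ k :=
    card_linear_form_eq_zero hφ0 hWr
  set K := Finset.univ.filter fun u : W => φ u = 0 with hK
  set Z := Finset.univ.filter fun u : W => differential f u y = 0 with hZ
  have hKZ : K ⊆ Z := fun u hu => by
    simp only [hK, hZ, Finset.mem_filter, Finset.mem_univ, true_and] at hu ⊢
    exact ker_le u hu
  have bound : ∀ u : W,
      (Finset.univ.filter fun t : F => t ≠ 0 ∧ (linePoly f (y + a) u).eval t = 0).card +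
        (if u ∈ Z then 1 else 0) ≤
      (s - 1) + (if u ∈ K then Fintype.card F - (s - 1) else 0) := by
    intro u
    by_cases huZ : u ∈ Z
    · have huZ' : differential f u y = 0 := by simpa [hZ] using huZ
      by_cases huK : u ∈ K
      · simp only [huZ, huK, if_true]
        have : (Finset.univ.filter fun t : F => t ≠ 0 ∧
            (linePoly f (y + a) u).eval t = 0).card < Fintype.card F := by
          refine Finset.card_lt_univ_of_notMem (x := 0) ?_
          simp
        omega
      · simp only [huZ, huK, if_true, if_false]
        have huK' : φ u ≠ 0 := by simpa [hK] using huK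
        have hP : linePoly f (y + a) u ≠ 0 := by
          intro h
          rw [hφu, h] at huK'
          simp at huK'
        have := card_nonzero_roots_add_le (j := 1) hP
          (natDegree_linePoly_le_pred hf _ (hW u u.2)
            (by rw [differential_add_of_mem hf hs hW, huZ']))
          (by
            intro i hi
            interval_cases i
            rw [coeff_zero_linePoly, ha])
        omega
    · have huZ' : differential f u y ≠ 0 := by simpa [hZ] using huZ
      have := exact_line u huZ' a
      have := hcard u
      simp only [huZ, mt (@hKZ u) huZ, if_false]
      omega
  have total := Finset.sum_le_sum fun (u : W) (_ : u ∈ Finset.univ) => bound u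
  rw [Finset.sum_add_distrib, Finset.sum_add_distrib, sum_card_zeros_concurrent_lines,
    cosetZeros_add_mem, hy, Finset.sum_const, Finset.card_univ, hWc, Finset.sum_ite_mem,
    Finset.sum_ite_mem, Finset.univ_inter, Finset.univ_inter, Finset.sum_const, Finset.sum_const,
    hker] at total
  refine le_antisymm ?_ (hker ▸ Finset.card_le_card hKZ)
  obtain ⟨r, rfl⟩ : ∃ r, s = r + 1 := ⟨s - 1, by omega⟩
  obtain ⟨c, hc⟩ : ∃ c, Fintype.card F = r + c := ⟨Fintype.card F - r, by omega⟩
  have hq1 : Fintype.card F - 1 + 1 = Fintype.card F := by omega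
  have hc' : Fintype.card F - (r + 1 - 1) = c := by omega
  rw [hc'] at total
  simp only [smul_eq_mul, mul_one, add_tsub_cancel_right, pow_succ] at total
  generalize Fintype.card F ^ k = Q at *
  generalize Fintype.card F - 1 = p at *
  rw [← hq1] at total
  have : p + 1 = r + c := by omega
  nlinarith

theorem card_zeros_eq (hf : f.IsHomogeneous e) (he : e ≠ 0) :
    (Finset.univ.filter fun v : Fin m → F => MvPolynomial.eval v f = 0).card =
      (Fintype.card F - 1) * numPoints f + 1 := by
  let g : {p : Projectivization F (Fin m → F) // MvPolynomial.eval p.rep f = 0} × Fˣ →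
      {v : Fin m → F // v ≠ 0 ∧ MvPolynomial.eval v f = 0} := fun x =>
    ⟨(x.2 : F) • x.1.1.rep, smul_ne_zero x.2.ne_zero x.1.1.rep_nonzero, by
      rw [eval_smul_of_isHomogeneous hf, x.1.2, mul_zero]⟩
  have hg : Function.Bijective g := by
    constructor
    · rintro ⟨⟨p, hp⟩, c⟩ ⟨⟨p', hp'⟩, c'⟩ h
      have h' : (c : F) • p.rep = (c' : F) • p'.rep := congrArg Subtype.val h
      have hpp : p = p' := by
        rw [← p.mk_rep, ← p'.mk_rep, Projectivization.mk_eq_mk_iff]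
        refine ⟨c⁻¹ * c', ?_⟩
        rw [mul_smul, Units.smul_def c', ← h', Units.smul_def, smul_smul]
        simp
      subst hpp
      have := smul_left_injective F p.rep_nonzero h'
      simp [Units.ext this]
    · rintro ⟨v, hv, hfv⟩
      obtain ⟨a, ha⟩ := Projectivization.exists_smul_eq_mk_rep F v hv
      refine ⟨⟨⟨Projectivization.mk F v hv, ?_⟩, a⁻¹⟩, Subtype.ext ?_⟩
      · rw [← ha, Units.smul_def, eval_smul_of_isHomogeneous hf, hfv, mul_zero]
      · change ((a⁻¹ : Fˣ) : F) • (Projectivization.mk F v hv).rep = v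
        rw [← ha, ← Units.smul_def, inv_smul_smul]
  have h0 : MvPolynomial.eval (0 : Fin m → F) f = 0 := by
    simpa [he] using eval_smul_of_isHomogeneous hf (0 : F) 0
  have h := Nat.card_congr (Equiv.ofBijective g hg)
  rw [Nat.card_prod, Nat.card_eq_fintype_card (α := Fˣ), Fintype.card_units,
    Nat.card_eq_fintype_card (α := {v : Fin m → F // _}), Fintype.card_subtype,
    ← Finset.filter_filter, Finset.filter_ne', Finset.filter_erase] at h
  rw [mul_comm, numPoints, h, Finset.card_erase_add_one]
  simpa using h0

theorem sum_cosetZeros_notMem [DecidablePred (· ∈ W)] :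
    ∑ y : Fin m → F with y ∉ W, cosetZeros f W y =
      Fintype.card W *
        (Finset.univ.filter fun v : Fin m → F => v ∉ W ∧ MvPolynomial.eval v f = 0).card := by
  have h : ∀ a : W, (∑ y : Fin m → F with y ∉ W,
      if MvPolynomial.eval (y + (a : Fin m → F)) f = 0 then 1 else 0) =
      (Finset.univ.filter fun v : Fin m → F => v ∉ W ∧ MvPolynomial.eval v f = 0).card := by
    intro a
    rw [← Finset.card_filter, Finset.filter_filter]
    refine Finset.card_equiv (Equiv.addRight (a : Fin m → F)) fun y => ?_
    simp [W.add_mem_iff_left a.2]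
  simp only [cosetZeros, Finset.card_filter _ (Finset.univ : Finset W)]
  rw [Finset.sum_comm, Finset.sum_congr rfl fun a _ => h a, Finset.sum_const, Finset.card_univ,
    smul_eq_mul]

theorem card_notMem_zeros_add {n : ℕ} {f : MvPolynomial (Fin m) F} {W : Submodule F (Fin m → F)}
    [Fintype W] [DecidablePred (· ∈ W)]
    (hkn : k ≤ n) (hf : f.IsHomogeneous (s + 1)) (hW : SubInX f W)
    (hWr : Module.finrank F W = k + 1)
    (heq : numPoints f = Theta (Fintype.card F) (s + 1) n k) :
    (Finset.univ.filter fun v : Fin m → F => v ∉ W ∧ MvPolynomial.eval v f = 0).card +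
      s * Fintype.card F ^ k = s * Fintype.card F ^ (n + 1) := by
  have hz := card_zeros_eq hf (Nat.succ_ne_zero s)
  have hsplit := Finset.card_filter_add_card_filter_not
    (s := Finset.univ.filter fun v : Fin m → F => MvPolynomial.eval v f = 0) (· ∈ W)
  have hin : ((Finset.univ.filter fun v : Fin m → F => MvPolynomial.eval v f = 0).filter
      (· ∈ W)).card = Fintype.card F ^ (k + 1) := by
    rw [← hWr, ← Module.card_eq_pow_finrank (K := F), Finset.filter_filter,
      Finset.filter_congr (q := fun v => v ∈ W) fun v _ => ⟨And.right, fun h => ⟨hW v h, h⟩⟩,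
      ← Fintype.card_subtype]
  have hout : ((Finset.univ.filter fun v : Fin m → F => MvPolynomial.eval v f = 0).filter
      (· ∉ W)) = Finset.univ.filter fun v : Fin m → F => v ∉ W ∧ MvPolynomial.eval v f = 0 := by
    rw [Finset.filter_filter]
    simp only [and_comm]
  rw [hin, hout, hz, heq, Theta, NP, NP, add_tsub_cancel_right] at hsplit
  obtain ⟨p, hp⟩ : ∃ p, Fintype.card F = p + 1 :=
    ⟨Fintype.card F - 1, by have := Fintype.card_pos (α := F); omega⟩
  rw [hp, add_tsub_cancel_right] at hsplit
  rw [hp]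
  have h1 := geom_sum_mul_add p (k + 1)
  have h2 := geom_sum_mul_add p (n - k + 1)
  have h3 : (p + 1) ^ (n + 1) = (p + 1) ^ k * (p + 1) ^ (n - k + 1) := by
    rw [← pow_add]
    congr 1
    omega
  rw [h3, ← h2]
  rw [← h1] at hsplit
  linarith

theorem two_mul_eq_of_forall_differential_ne_zero {n : ℕ} (hs2 : 2 ≤ s)
    (hs : s + 1 < Fintype.card F) (hkn : k ≤ n) {f : MvPolynomial (Fin (n + 2)) F}
    (hf : f.IsHomogeneous (s + 1)) (hthas : ThasEq f k)
    (heq : numPoints f = Theta (Fintype.card F) (s + 1) n k)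
    (hns : ∀ v : Fin (n + 2) → F, v ≠ 0 → MvPolynomial.eval v f = 0 → differential f v ≠ 0) :
    2 * k = n := by
  classical
  obtain ⟨⟨W, hWr, hW⟩, hmax⟩ := hthas
  have hWc : Fintype.card W = Fintype.card F ^ (k + 1) := by
    rw [Module.card_eq_pow_finrank (K := F), hWr]
  have hV : Fintype.card (Fin (n + 2) → F) = Fintype.card F ^ (n + 2) := by simp
  have hne := fun y (hy : y ∉ W) => exists_eval_add_ne_zero hf hWr hW hmax hy
  have hle : ∀ y ∈ Finset.univ.filter (· ∉ W), cosetZeros f W y ≤ s * Fintype.card F ^ k := by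
    intro y hy
    by_cases h : ∃ u : W, differential f u y ≠ 0
    · obtain ⟨u, hu⟩ := h
      exact cosetZeros_le_of_differential_ne_zero hf hs hW hWc hu
    · push Not at h
      exact (cosetZeros_lt_of_differential_eq_zero hf (by omega) hs hW hWc h
        (hne y (by simpa using hy))).le
  have hcardW : (Finset.univ.filter (· ∈ W)).card = Fintype.card F ^ (k + 1) := by
    rw [← hWc, Fintype.card_subtype]
  have hcard : (Finset.univ.filter (· ∈ W)).card + (Finset.univ.filter (· ∉ W)).card =
      Fintype.card F ^ (n + 2) := by
    rw [Finset.card_filter_add_card_filter_not, Finset.card_univ, hV]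
  rw [hcardW] at hcard
  have heach : ∀ y ∉ W, cosetZeros f W y = s * Fintype.card F ^ k := by
    intro y hy
    refine (Finset.sum_eq_sum_iff_of_le hle).1 ?_ y (by simpa using hy)
    rw [sum_cosetZeros_notMem, Finset.sum_const, hWc, smul_eq_mul]
    have h := card_notMem_zeros_add hkn hf hW hWr heq
    zify at h hcard ⊢
    rw [← eq_sub_iff_add_eq'] at hcard
    rw [← eq_sub_iff_add_eq] at h
    rw [hcard, h]
    ring
  have hZ : ∀ y ∉ W, (Finset.univ.filter fun u : W => differential f u y = 0).card =
      Fintype.card F ^ k := by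
    intro y hy
    refine card_differential_eq_zero hf hs2 hs hW hWr ?_ (heach y hy)
    by_contra! h
    exact (cosetZeros_lt_of_differential_eq_zero hf (by omega) hs hW hWc h (hne y hy)).ne
      (heach y hy)
  have hdouble : ∑ y : Fin (n + 2) → F,
      (Finset.univ.filter fun u : W => differential f u y = 0).card =
      ∑ u : W, (Finset.univ.filter fun y : Fin (n + 2) → F => differential f u y = 0).card := by
    simp only [Finset.card_filter]
    exact Finset.sum_comm
  have hleft : ∑ y : Fin (n + 2) → F,
      (Finset.univ.filter fun u : W => differential f u y = 0).card =
      Fintype.card F ^ (k + 1) * Fintype.card F ^ (k + 1) +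
        (Finset.univ.filter (· ∉ W)).card * Fintype.card F ^ k := by
    rw [← Finset.sum_filter_add_sum_filter_not Finset.univ (· ∈ W),
      Finset.sum_congr (s₁ := Finset.univ.filter (· ∈ W))
        (g := fun _ => Fintype.card F ^ (k + 1)) rfl fun y hy => ?_,
      Finset.sum_congr (s₁ := Finset.univ.filter (· ∉ W))
        (g := fun _ => Fintype.card F ^ k) rfl fun y hy => ?_,
      Finset.sum_const, Finset.sum_const, hcardW, smul_eq_mul, smul_eq_mul]
    · exact hZ y (by simpa using hy)
    · rw [← hWc, ← Finset.card_univ, Finset.filter_true_of_mem]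
      intro u _
      exact differential_eq_zero_of_mem hf hs hW u.2 (by simpa using hy)
  have hzero : ∀ y, differential f 0 y = 0 := by
    intro y
    rw [← coeff_linePoly_eq_differential hf]
    have hC : linePoly f y 0 = Polynomial.C (MvPolynomial.eval y f) := by
      unfold linePoly
      simp only [Pi.zero_apply, map_zero, zero_mul, add_zero]
      exact (MvPolynomial.comp_aeval_apply (R := F) (f := y)
        (φ := Algebra.ofId F (Polynomial F)) f).symm
    rw [hC, Polynomial.coeff_C_of_ne_zero (by omega)]
  have hright : ∑ u : W,
      (Finset.univ.filter fun y : Fin (n + 2) → F => differential f u y = 0).card =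
      Fintype.card F ^ (n + 2) + (Fintype.card F ^ (k + 1) - 1) * Fintype.card F ^ (n + 1) := by
    rw [← Finset.add_sum_erase _ _ (Finset.mem_univ (0 : W)),
      Finset.sum_congr (g := fun _ => Fintype.card F ^ (n + 1)) rfl fun u hu => ?_,
      Finset.sum_const, Finset.card_erase_of_mem (Finset.mem_univ _), Finset.card_univ, hWc,
      smul_eq_mul]
    · simp [hzero]
    · refine card_linear_form_eq_zero (hns u ?_ (hW u u.2)) (by simp)
      simpa using Finset.ne_of_mem_erase hu
  rw [hleft, hright] at hdouble
  have hq0 : 0 < Fintype.card F := by omega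
  have hpos : 1 ≤ Fintype.card F ^ (k + 1) := Nat.one_le_pow _ _ hq0
  refine Nat.pow_right_injective (show 2 ≤ Fintype.card F by omega) ?_
  zify [hpos] at hdouble hcard ⊢
  rw [← eq_sub_iff_add_eq'] at hcard
  rw [hcard] at hdouble
  have hq1 : (1 : ℤ) < Fintype.card F := by exact_mod_cast (show 1 < Fintype.card F by omega)
  have hfac : ((Fintype.card F : ℤ) * (Fintype.card F - 1)) ≠ 0 := by
    have : (0 : ℤ) < Fintype.card F - 1 := by linarith
    positivity
  refine mul_left_cancel₀ hfac ?_
  rw [pow_mul']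
  ring_nf at hdouble ⊢
  linarith

end

theorem stmt18 {F : Type*} [Field F] [Fintype F] {n k s : ℕ}
    (hq : Fintype.card F = s ^ 2) (hn : Odd n) (hn1 : 1 ≤ n)
    (hk1 : 0 < k) (hkn : k ≤ n - 1)
    (f : MvPolynomial (Fin (n + 2)) F) (hf0 : f ≠ 0) (hsq : Squarefree f)
    (hhom : f.IsHomogeneous (s + 1)) (hthas : ThasEq f k)
    (heq : numPoints f = Theta (Fintype.card F) (s + 1) n k) :
    ∃ v : Fin (n + 2) → F, IsSingPt f v := by
  classical
  have hs2 : 2 ≤ s := by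
    have := Fintype.one_lt_card (α := F)
    by_contra! h
    interval_cases s <;> omega
  have hs : s + 1 < Fintype.card F := by
    rw [hq]
    nlinarith
  by_contra! hsing
  have h := two_mul_eq_of_forall_differential_ne_zero hs2 hs (hkn.trans (Nat.sub_le n 1)) hhom
    hthas heq fun v hv hfv hd => hsing v ⟨hv, hfv, fun i => by
      simpa [differential_apply, Pi.single_apply] using LinearMap.congr_fun hd (Pi.single i 1)⟩
  exact Nat.not_even_iff_odd.2 hn ⟨k, by omega⟩
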